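/- arXiv:1710.10528 — 9 statements merged into one kernel-verified Lean document; each statement's English description precedes it below -/
import Mathlib

section
/- Let A be an associative (not necessarily commutative) ring, let e, a ∈ A and let k ∈ ℕ satisfy (ad e)^{k+1} a = 0. Then for every n ∈ ℕ one has e^{k+n} · a = a' · e^n, where a' = Σ_{i=0}^{k} (n+k choose i) · ((ad e)^i a) · e^{k−i}. -/
/-- The expansion of `e ^ m * a` obtained by writing left multiplication by `e` as the sum of the
commuting maps `ad e` and right multiplication by `e`. -/
theorem pow_mul_eq_sum_ad_iterate {A : Type*} [Ring A] (e a : A) (m : ℕ) :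
    e ^ m * a = ∑ i ∈ Finset.range (m + 1),
      m.choose i • ((fun x => e * x - x * e)^[i] a * e ^ (m - i)) := by
  have hcomm : Commute (LinearMap.mulLeft ℤ e - LinearMap.mulRight ℤ e)
      (LinearMap.mulRight ℤ e) :=
    (LinearMap.commute_mulLeft_right e e).sub_left (Commute.refl _)
  have hpow := congrArg (fun f : Module.End ℤ A => f a) (hcomm.add_pow m)
  simp only [sub_add_cancel, LinearMap.pow_mulLeft, LinearMap.mulLeft_apply,
    LinearMap.sum_apply] at hpow
  rw [hpow]
  refine Finset.sum_congr rfl fun i _ => ?_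
  rw [(hcomm.pow_pow i (m - i)).eq, ← nsmul_eq_mul', LinearMap.smul_apply, Module.End.mul_apply,
    LinearMap.pow_mulRight, LinearMap.mulRight_apply, Module.End.pow_apply]
  rfl


/-- If `(ad e)^(k+1) a = 0`, then for every `n`,
`e^(k+n) * a = a' * e^n` with
`a' = ∑_{i=0}^{k} ((n+k) choose i) * ((ad e)^i a) * e^(k-i)`,
where `(ad e) x = e * x - x * e`. -/
theorem stmt_1 {A : Type*} [Ring A] (e a : A) (k : ℕ)
    (h : (fun x => e * x - x * e)^[k + 1] a = 0) (n : ℕ) :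
    e ^ (k + n) * a =
      (∑ i ∈ Finset.range (k + 1),
        ((n + k).choose i) • ((fun x => e * x - x * e)^[i] a * e ^ (k - i))) * e ^ n := by
  rw [pow_mul_eq_sum_ad_iterate, Finset.sum_mul]
  symm
  refine Finset.sum_subset_zero_on_sdiff (Finset.range_subset_range.2 (by omega)) ?_ ?_
  · intro i hi
    simp only [Finset.mem_sdiff, Finset.mem_range, not_lt] at hi
    obtain ⟨j, rfl⟩ := Nat.exists_eq_add_of_le' hi.2
    have hzero : (fun x => e * x - x * e)^[j] 0 = 0 :=
      Function.iterate_fixed (by simp) j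
    rw [Function.iterate_add_apply, h, hzero, zero_mul, smul_zero]
  · intro i hi
    have hik : i ≤ k := Nat.lt_succ_iff.1 (Finset.mem_range.1 hi)
    rw [smul_mul_assoc, mul_assoc, ← pow_add, Nat.sub_add_comm hik, add_comm n k]
end

section
/- Let A be an associative (not necessarily commutative) ring and let T ⊆ A be a set each of whose elements t is locally ad-nilpotent, i.e. for every a ∈ A there exists N ∈ ℕ with (ad t)^N a = 0. Let S be the multiplicative submonoid of A generated by T, and assume every element of S is a non-zero-divisor in A. Then S is an Ore set in A; in particular S satisfies the left Ore condition: for every a ∈ A and every s ∈ S there exist a' ∈ A and s' ∈ S with s' · a = a' · s. -/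
/-- If some iterate of `ad t` kills `a`, then a left multiple of `a` by a power of `t` is a left
multiple of `t`. -/
theorem exists_pow_mul_eq_mul_of_iterate_commutator_eq_zero {A : Type*} [Ring A] (t : A) (N : ℕ)
    (a : A) (h : (fun x => t * x - x * t)^[N] a = 0) : ∃ a' : A, t ^ N * a = a' * t := by
  induction N generalizing a with
  | zero => exact ⟨0, by simpa using h⟩
  | succ N ih =>
    obtain ⟨a', ha'⟩ := ih _ h
    refine ⟨a' + t ^ N * a, ?_⟩
    rw [add_mul, ← ha', pow_succ]
    noncomm_ring

/-- The left Ore condition passes from a generating set to the submonoid it generates. -/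
theorem Submonoid.exists_mul_eq_mul_of_mem_closure {A : Type*} [Monoid A] {T : Set A}
    (hT : ∀ t ∈ T, ∀ a : A, ∃ a' : A, ∃ s' ∈ Submonoid.closure T, s' * a = a' * t) (a : A)
    {s : A} (hs : s ∈ Submonoid.closure T) :
    ∃ a' : A, ∃ s' ∈ Submonoid.closure T, s' * a = a' * s := by
  induction hs using Submonoid.closure_induction generalizing a with
  | mem t ht => exact hT t ht a
  | one => exact ⟨a, 1, one_mem _, by simp⟩
  | mul x y _ _ ihx ihy =>
    obtain ⟨b, u, hu, hb⟩ := ihy a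
    obtain ⟨c, v, hv, hc⟩ := ihx b
    exact ⟨c, v * u, mul_mem hv hu, by rw [mul_assoc, hb, ← mul_assoc, hc, mul_assoc]⟩

/-- If `T` is a set of locally ad-nilpotent elements of a ring `A`, and every element of the
multiplicative submonoid `S` generated by `T` is a non-zero-divisor, then `S` is a (left) Ore
set in `A`: in particular, for every `a ∈ A` and `s ∈ S` there exist `a' ∈ A` and `s' ∈ S`
with `s' * a = a' * s`. -/
theorem stmt_2 {A : Type*} [Ring A] (T : Set A)
    (hT : ∀ t ∈ T, ∀ a : A, ∃ N : ℕ, (fun x => t * x - x * t)^[N] a = 0)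
    (hreg : ∀ s ∈ Submonoid.closure T, s ∈ nonZeroDivisors A) :
    Nonempty (OreLocalization.OreSet (Submonoid.closure T)) ∧
      ∀ a : A, ∀ s ∈ Submonoid.closure T,
        ∃ a' : A, ∃ s' ∈ Submonoid.closure T, s' * a = a' * s := by
  have ore : ∀ a : A, ∀ s ∈ Submonoid.closure T,
      ∃ a' : A, ∃ s' ∈ Submonoid.closure T, s' * a = a' * s := fun a s hs => by
    refine Submonoid.exists_mul_eq_mul_of_mem_closure (fun t ht b => ?_) a hs
    obtain ⟨N, hN⟩ := hT t ht b
    obtain ⟨b', hb'⟩ := exists_pow_mul_eq_mul_of_iterate_commutator_eq_zero t N b hN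
    exact ⟨b', t ^ N, pow_mem (Submonoid.subset_closure ht) N, hb'⟩
  refine ⟨OreLocalization.nonempty_oreSet_iff.mpr ⟨fun r₁ r₂ s h => ⟨1, ?_⟩, fun r s => ?_⟩, ore⟩
  · rw [mul_cancel_right_mem_nonZeroDivisors (hreg s s.2) |>.mp h]
  · obtain ⟨a', s', hs', h⟩ := ore r s s.2
    exact ⟨a', ⟨s', hs'⟩, h⟩
end

section
/- Let A be an associative (not necessarily commutative) ring, let x, z ∈ A, and let ε ∈ {1, −1} (the parity sign of z). Define z^{[0]} = z and z^{[j+1]} = x·z^{[j]} − ε·(−1)^j·z^{[j]}·x for j ≥ 0. Then for every ℓ ∈ ℕ: x^{2ℓ+1} · z = Σ_{i=0}^{ℓ} (ℓ choose i) · z^{[2i+1]} · x^{2ℓ−2i} + ε · Σ_{i=0}^{ℓ} (ℓ choose i) · z^{[2i]} · x^{2ℓ−2i+1}. -/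
theorem pow_mul_eq_sum_antidiagonal_choose {A : Type*} [Ring A] (y : A) (g : ℕ → A)
    (hg : ∀ i, y * g i = g (i + 1) + g i * y) (n : ℕ) :
    y ^ n * g 0 =
      ∑ ij ∈ Finset.HasAntidiagonal.antidiagonal n, n.choose ij.1 • (g ij.1 * y ^ ij.2) := by
  induction n with
  | zero => simp
  | succ n ih =>
    rw [Finset.sum_antidiagonal_choose_succ_nsmul (fun i j => g i * y ^ j), pow_succ', mul_assoc,
      ih, Finset.mul_sum, ← Finset.sum_add_distrib]
    refine Finset.sum_congr rfl fun ij hij => ?_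
    rw [← Nat.choose_symm_of_eq_add (Finset.HasAntidiagonal.mem_antidiagonal.1 hij).symm, ← smul_add,
      mul_smul_comm, ← mul_assoc, hg, add_mul, mul_assoc, ← pow_succ', add_comm]

theorem pow_two_mul_mul_eq_sum_range_choose {A : Type*} [Ring A] (x : A) (g : ℕ → A)
    (hg : ∀ i, x ^ 2 * g i = g (i + 1) + g i * x ^ 2) (n : ℕ) :
    x ^ (2 * n) * g 0 =
      ∑ i ∈ Finset.range (n + 1), n.choose i • (g i * x ^ (2 * n - 2 * i)) := by
  rw [pow_mul, pow_mul_eq_sum_antidiagonal_choose _ g hg,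
    Finset.Nat.sum_antidiagonal_eq_sum_range_succ_mk]
  simp only [← pow_mul, Nat.mul_sub]

theorem sq_mul_eq_of_odd_supercommutator {A : Type*} [Ring A] {x ε : A} (hε : ε = 1 ∨ ε = -1)
    {f : ℕ → A} (hf : ∀ j : ℕ, f (j + 1) = x * f j - ε * (-1 : A) ^ j * (f j * x)) (j : ℕ) :
    x ^ 2 * f j = f (j + 2) + f j * x ^ 2 := by
  rw [hf (j + 1), hf j, pow_succ (-1 : A) j]
  rcases hε with rfl | rfl <;> rcases neg_one_pow_eq_or A j with h | h <;> rw [h] <;> noncomm_ring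


/-- The odd analogue of the binomial formula: if `f j` denotes `z^{[j]}` defined by
`z^{[0]} = z` and `z^{[j+1]} = x * z^{[j]} - ε * (-1)^j * z^{[j]} * x` (with `ε = ±1`
the parity sign of `z`), then
`x^(2ℓ+1) * z = ∑_{i=0}^{ℓ} (ℓ choose i) z^{[2i+1]} x^(2ℓ-2i)
             + ε * ∑_{i=0}^{ℓ} (ℓ choose i) z^{[2i]} x^(2ℓ-2i+1)`. -/
theorem stmt_3 {A : Type*} [Ring A] (x z ε : A) (hε : ε = 1 ∨ ε = -1)
    (f : ℕ → A) (hf0 : f 0 = z)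
    (hf : ∀ j : ℕ, f (j + 1) = x * f j - ε * (-1 : A) ^ j * (f j * x))
    (ℓ : ℕ) :
    x ^ (2 * ℓ + 1) * z =
      (∑ i ∈ Finset.range (ℓ + 1), (ℓ.choose i) • (f (2 * i + 1) * x ^ (2 * ℓ - 2 * i))) +
        ε * ∑ i ∈ Finset.range (ℓ + 1), (ℓ.choose i) • (f (2 * i) * x ^ (2 * ℓ - 2 * i + 1)) := by
  have hsq := sq_mul_eq_of_odd_supercommutator hε hf
  have h_odd := pow_two_mul_mul_eq_sum_range_choose x (fun i => f (2 * i + 1))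
    (fun i => hsq (2 * i + 1)) ℓ
  have h_even := pow_two_mul_mul_eq_sum_range_choose x (fun i => f (2 * i))
    (fun i => hsq (2 * i)) ℓ
  have hxz : x * z = f 1 + ε * (f 0 * x) := by simp [hf 0, hf0]
  have h_comm : x ^ (2 * ℓ) * ε = ε * x ^ (2 * ℓ) := by rcases hε with rfl | rfl <;> simp
  simp only [pow_succ x, ← mul_assoc, ← smul_mul_assoc, ← Finset.sum_mul] at h_odd h_even ⊢
  simp only [smul_mul_assoc] at h_odd h_even ⊢
  rw [← h_odd, ← h_even, mul_assoc, hxz, mul_add, ← mul_assoc _ ε, h_comm]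
  simp only [mul_assoc, mul_zero, zero_add]
end

section
/- Let B = (b_{p,q}) be an n×n upper Hessenberg matrix (b_{p,q} = 0 whenever p > q+1) with entries in an associative (not necessarily commutative) ring, fix 1 ≤ q ≤ n−1, set T = b_{q+1,q}, and assume T commutes with every entry of B. Let B' be the matrix obtained from B by replacing the (q+1, q) entry by 0, and let B'' be the (n−1)×(n−1) matrix obtained from B by deleting row q+1 and column q. Then det→(B) = −T · det→(B'') + det→(B'). -/
/-- The left-to-right determinant of a square matrix over a (not necessarily commutative)
ring: `det→(B) = Σ_{w} sign(w) · b_{w(1),1} · b_{w(2),2} ⋯ b_{w(k),k}`, the factors being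
multiplied in increasing order of the column index. -/
noncomputable def detLR {A : Type*} [Ring A] {k : ℕ} (B : Matrix (Fin k) (Fin k) A) : A :=
  ∑ w : Equiv.Perm (Fin k), (Equiv.Perm.sign w : ℤ) • (List.ofFn fun q => B (w q) q).prod

/-- A factor commuting with all the factors of an ordered product can be moved to the front. -/
theorem List.prod_ofFn_eq_mul_succAbove {M : Type*} [Monoid M] {n : ℕ} (f : Fin (n + 1) → M)
    (p : Fin (n + 1)) (h : ∀ i, Commute (f p) (f i)) :
    (List.ofFn f).prod = f p * (List.ofFn fun i => f (p.succAbove i)).prod := by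
  induction n with
  | zero => simp [Fin.fin_one_eq_zero p]
  | succ n ih =>
    rw [List.ofFn_succ, List.prod_cons]
    cases p using Fin.cases with
    | zero => simp
    | succ p =>
      rw [ih (fun i => f i.succ) p fun i => h i.succ, List.ofFn_succ, List.prod_cons, ← mul_assoc,
        ← (h 0).eq, mul_assoc]
      simp

/-- The permutations of `Fin (m + 1)`, parametrised by the (shifted) image of `c` and a
permutation of `Fin m`; the permutations mapping `c` to `r` are those with parameter `0`. -/
def permEquivOfImage {m : ℕ} (r c : Fin (m + 1)) :
    Fin (m + 1) × Equiv.Perm (Fin m) ≃ Equiv.Perm (Fin (m + 1)) :=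
  (Equiv.Perm.decomposeFin.symm.trans (Equiv.mulRight c.cycleRange)).trans
    (Equiv.mulLeft r.cycleRange⁻¹)

theorem permEquivOfImage_apply_self {m : ℕ} (r c p : Fin (m + 1)) (σ : Equiv.Perm (Fin m)) :
    permEquivOfImage r c (p, σ) c = r.cycleRange.symm p := by
  simp [permEquivOfImage, Equiv.Perm.inv_def]

theorem permEquivOfImage_zero_succAbove {m : ℕ} (r c : Fin (m + 1)) (σ : Equiv.Perm (Fin m))
    (i : Fin m) :
    permEquivOfImage r c (0, σ) (c.succAbove i) = r.succAbove (σ i) := by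
  simp [permEquivOfImage, Equiv.Perm.inv_def]

theorem sign_permEquivOfImage_zero {m : ℕ} (r c : Fin (m + 1)) (σ : Equiv.Perm (Fin m)) :
    Equiv.Perm.sign (permEquivOfImage r c (0, σ)) =
      (-1) ^ ((r : ℕ) + (c : ℕ)) * Equiv.Perm.sign σ := by
  simp [permEquivOfImage, Equiv.Perm.decomposeFin.symm_sign, Fin.sign_cycleRange, pow_add,
    mul_assoc, mul_comm (Equiv.Perm.sign σ)]

/-- Expansion of the left-to-right determinant along a single entry commuting with all entries. -/
theorem detLR_eq_entry_mul_add {A : Type*} [Ring A] {m : ℕ}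
    (B : Matrix (Fin (m + 1)) (Fin (m + 1)) A) (r c : Fin (m + 1))
    (h : ∀ p s, Commute (B r c) (B p s)) :
    detLR B = (-1) ^ ((r : ℕ) + (c : ℕ)) * B r c *
        detLR (B.submatrix r.succAbove c.succAbove) +
      detLR (Matrix.of fun p s => if p = r ∧ s = c then 0 else B p s) := by
  have key (N : Matrix (Fin (m + 1)) (Fin (m + 1)) A) (hN : ∀ p s, Commute (N r c) (N p s)) :
      detLR N = (-1) ^ ((r : ℕ) + (c : ℕ)) * N r c *
          detLR (N.submatrix r.succAbove c.succAbove) +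
        ∑ p : Fin m, ∑ σ : Equiv.Perm (Fin m),
          (Equiv.Perm.sign (permEquivOfImage r c (p.succ, σ)) : ℤ) •
            (List.ofFn fun s => N (permEquivOfImage r c (p.succ, σ) s) s).prod := by
    rw [detLR, ← (permEquivOfImage r c).sum_comp, Fintype.sum_prod_type, Fin.sum_univ_succ, detLR,
      Finset.mul_sum]
    congr 1
    refine Finset.sum_congr rfl fun σ _ => ?_
    have hc : permEquivOfImage r c (0, σ) c = r := by simp [permEquivOfImage_apply_self]
    rw [List.prod_ofFn_eq_mul_succAbove _ c (by simpa only [hc] using fun i => hN _ _), hc,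
      sign_permEquivOfImage_zero]
    simp [permEquivOfImage_zero_succAbove, zsmul_eq_mul, mul_assoc,
      (Int.cast_commute ((Equiv.Perm.sign σ : ℤˣ) : ℤ) (N r c)).left_comm]
  rw [key B h, key (Matrix.of fun p s => if p = r ∧ s = c then 0 else B p s) (by simp)]
  simp only [Matrix.of_apply, and_self, if_true, mul_zero, zero_mul, zero_add]
  congr 1
  refine Finset.sum_congr rfl fun p _ => Finset.sum_congr rfl fun σ _ => ?_
  congr 3
  ext s
  rw [if_neg]
  rintro ⟨hs, rfl⟩
  rw [permEquivOfImage_apply_self, Equiv.symm_apply_eq, Fin.cycleRange_self] at hs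
  exact Fin.succ_ne_zero p hs

/-- Expansion of the left-to-right determinant of an upper Hessenberg matrix `B` along a
central subdiagonal entry `T = b_{q+1,q}` which commutes with every entry of `B`:
`det→(B) = −T · det→(B'') + det→(B')`, where `B'` is obtained from `B` by replacing the
`(q+1, q)` entry by `0`, and `B''` by deleting row `q+1` and column `q`
(1-indexed; here `0`-indexed with row `q.succ` and column `q.castSucc`). -/
theorem stmt_8 {A : Type*} [Ring A] {m : ℕ} (B : Matrix (Fin (m + 1)) (Fin (m + 1)) A)
    (hHess : ∀ p q : Fin (m + 1), (q : ℕ) + 1 < (p : ℕ) → B p q = 0)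
    (q : Fin m)
    (hcomm : ∀ p r : Fin (m + 1), Commute (B q.succ q.castSucc) (B p r)) :
    detLR B =
      -(B q.succ q.castSucc) * detLR (B.submatrix q.succ.succAbove q.castSucc.succAbove) +
        detLR (Matrix.of fun p r : Fin (m + 1) =>
          if p = q.succ ∧ r = q.castSucc then 0 else B p r) := by
  rw [detLR_eq_entry_mul_add B q.succ q.castSucc hcomm]
  congr 2
  rw [Fin.val_succ, Fin.val_castSucc, Odd.neg_one_pow ⟨q, by ring⟩, neg_one_mul]
end

section
/- Let B = (b_{p,q}) be an (n+1)×n matrix with entries in an associative (not necessarily commutative) ring that is upper Hessenberg in the sense that b_{p,q} = 0 whenever p > q+1, and suppose b_{q+1,q} = 0 for some 1 ≤ q ≤ n. Then for every 1 ≤ i ≤ q, the n×n matrix M obtained from B by deleting row i is singular: det→(M) = 0 and det←(M) = 0. -/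
/-- The right-to-left determinant of a square matrix over a (not necessarily commutative)
ring: `det←(B) = Σ_{w} sign(w) · b_{w(k),k} ⋯ b_{w(1),1}`, the factors being multiplied in
decreasing order of the column index. -/
noncomputable def detRL {A : Type*} [Ring A] {k : ℕ} (B : Matrix (Fin k) (Fin k) A) : A :=
  ∑ w : Equiv.Perm (Fin k),
    (Equiv.Perm.sign w : ℤ) • (List.ofFn fun q => B (w q.rev) q.rev).prod

/-- A permutation of `Fin n` maps some `c ≤ q` to some `w c ≥ q`. -/
theorem Equiv.Perm.exists_le_le_apply {n : ℕ} (w : Equiv.Perm (Fin n)) (q : Fin n) :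
    ∃ c, c ≤ q ∧ q ≤ w c := by
  by_contra! h
  have hcard : (Finset.Iic q).card ≤ (Finset.Iio q).card :=
    Finset.card_le_card_of_injOn w
      (fun c hc => by simpa using h c (by simpa using hc)) w.injective.injOn
  simp at hcard

/-- If every transversal of `B` meets a zero entry, then `detLR B = 0`. -/
theorem detLR_eq_zero {A : Type*} [Ring A] {k : ℕ} {B : Matrix (Fin k) (Fin k) A}
    (h : ∀ w : Equiv.Perm (Fin k), ∃ c, B (w c) c = 0) : detLR B = 0 := by
  refine Finset.sum_eq_zero fun w _ => ?_
  obtain ⟨c, hc⟩ := h w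
  have hprod : (List.ofFn fun q => B (w q) q).prod = 0 :=
    List.prod_eq_zero (List.mem_ofFn.2 ⟨c, hc⟩)
  rw [hprod, smul_zero]

/-- If every transversal of `B` meets a zero entry, then `detRL B = 0`. -/
theorem detRL_eq_zero {A : Type*} [Ring A] {k : ℕ} {B : Matrix (Fin k) (Fin k) A}
    (h : ∀ w : Equiv.Perm (Fin k), ∃ c, B (w c) c = 0) : detRL B = 0 := by
  refine Finset.sum_eq_zero fun w _ => ?_
  obtain ⟨c, hc⟩ := h w
  have hprod : (List.ofFn fun q => B (w q.rev) q.rev).prod = 0 :=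
    List.prod_eq_zero (List.mem_ofFn.2 ⟨c.rev, by simpa using hc⟩)
  rw [hprod, smul_zero]

/-- If `B` is an `(n+1) × n` upper Hessenberg matrix whose subdiagonal entry `b_{q+1,q}`
vanishes, then for every row index `i ≤ q` (1-indexed `1 ≤ i ≤ q`; here `0`-indexed),
the square matrix obtained from `B` by deleting row `i` is singular: both its
left-to-right and its right-to-left determinants vanish. -/
theorem stmt_9 {A : Type*} [Ring A] {n : ℕ} (B : Matrix (Fin (n + 1)) (Fin n) A)
    (hHess : ∀ (p : Fin (n + 1)) (c : Fin n), (c : ℕ) + 1 < (p : ℕ) → B p c = 0)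
    (q : Fin n) (hq : B q.succ q = 0)
    (i : Fin (n + 1)) (hi : (i : ℕ) ≤ (q : ℕ)) :
    detLR (B.submatrix i.succAbove id) = 0 ∧ detRL (B.submatrix i.succAbove id) = 0 := by
  have hzero : ∀ w : Equiv.Perm (Fin n), ∃ c, B.submatrix i.succAbove id (w c) c = 0 := by
    intro w
    obtain ⟨c, hc, hw⟩ := w.exists_le_le_apply q
    refine ⟨c, ?_⟩
    have hiw : i ≤ (w c).castSucc := Fin.le_def.2 (hi.trans hw)
    rw [Matrix.submatrix_apply, id_eq, Fin.succAbove_of_le_castSucc _ _ hiw]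
    rcases (hc.trans hw).eq_or_lt with h | h
    · have hcq : c = q := le_antisymm hc (h ▸ hw)
      rw [← h, hcq, hq]
    · exact hHess _ _ (by simpa using h)
  exact ⟨detLR_eq_zero hzero, detRL_eq_zero hzero⟩
end

section
/- Let X be a finite set of pairwise orthogonal vectors in V, each of the form ε_p + c·δ_q with p ∈ {1,…,m}, q ∈ {1,…,n} and c ∈ {1,−1} (each such vector is an isotropic root). Then X is linearly independent over ℝ. -/
/-- Any finite set of pairwise orthogonal isotropic roots (vectors of the form
`ε_p ± δ_q` in `V = ℝ^m × ℝ^n` with the form `(ε_i,ε_j) = δ_{ij} = −(δ_i,δ_j)`,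
`(ε_i,δ_j) = 0`) is linearly independent over `ℝ`. -/
theorem stmt_14 {m n : ℕ} (hm : 1 ≤ m) (hn : 1 ≤ n)
    (X : Finset ((Fin m → ℝ) × (Fin n → ℝ)))
    (hshape : ∀ x ∈ X, ∃ (p : Fin m) (q : Fin n) (c : ℝ), (c = 1 ∨ c = -1) ∧
      x = ((Pi.single p 1 : Fin m → ℝ), c • (Pi.single q 1 : Fin n → ℝ)))
    (horth : ∀ x ∈ X, ∀ y ∈ X, x ≠ y →
      (∑ i, x.1 i * y.1 i) - (∑ j, x.2 j * y.2 j) = 0) :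
    LinearIndependent ℝ
      (fun v : (X : Set ((Fin m → ℝ) × (Fin n → ℝ))) => (v : (Fin m → ℝ) × (Fin n → ℝ))) := by
  choose p q c hc hx using hshape
  have hp_ne (v w : (X : Set ((Fin m → ℝ) × (Fin n → ℝ)))) (hne : v ≠ w) :
      p v v.2 ≠ p w w.2 := by
    intro hp
    have h := horth v v.2 w w.2 fun h => hne (Subtype.ext h)
    rw [hx v v.2, hx w w.2] at h
    simp only [hp, Pi.smul_apply, Pi.single_apply, smul_eq_mul, mul_ite, mul_one, mul_zero,
      Finset.sum_ite_eq', Finset.mem_univ, if_true] at h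
    by_cases hq : q w w.2 = q v v.2
    · have hcc : c v v.2 = c w w.2 := by
        rcases hc v v.2 with h₁ | h₁ <;> rcases hc w w.2 with h₂ | h₂ <;>
          simp [h₁, h₂, hq] at h ⊢
      exact hne (Subtype.ext (by rw [hx v v.2, hx w w.2, hp, hq, hcc]))
    · simp [hq] at h
  refine LinearIndependent.of_comp (LinearMap.fst ℝ _ _) ?_
  convert (Pi.basisFun ℝ (Fin m)).linearIndependent.comp
    (fun v : (X : Set ((Fin m → ℝ) × (Fin n → ℝ))) => p v v.2)
    (fun v w h => by_contra fun hne => hp_ne v w hne h) using 1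
  funext v
  simpa using congrArg Prod.fst (hx v v.2)
end

section
/- Let Y be a finite set of pairwise orthogonal odd positive roots of gl(m,n) (i.e. vectors ε_p − δ_q), and let β be any positive root of gl(m,n) with β ∉ Y. Then β does not lie in the ℝ-linear span of Y. -/
/-- The odd positive root `ε_p − δ_q` of `gl(m,n)`. -/
def oddRoot {m n : ℕ} (p : Fin m) (q : Fin n) : (Fin m → ℝ) × (Fin n → ℝ) :=
  (Pi.single p 1, -Pi.single q 1)

/-- Two odd roots that are equal or orthogonal share their first index exactly when they share
their second one. -/
lemma oddRoot_index_eq_iff {m n : ℕ} {Y : Set ((Fin m → ℝ) × (Fin n → ℝ))}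
    (horth : ∀ x ∈ Y, ∀ y ∈ Y, x ≠ y →
      (∑ i, x.1 i * y.1 i) - (∑ j, x.2 j * y.2 j) = 0)
    {p p' : Fin m} {q q' : Fin n} (h : oddRoot p q ∈ Y) (h' : oddRoot p' q' ∈ Y) :
    p = p' ↔ q = q' := by
  by_cases hne : oddRoot p q = oddRoot p' q'
  · have h₁ := congrFun (congrArg Prod.fst hne) p
    have h₂ := congrFun (congrArg Prod.snd hne) q
    simp only [oddRoot, Pi.single_apply, Pi.neg_apply, if_true] at h₁ h₂
    have hp : p = p' := by by_contra hp; simp [hp] at h₁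
    have hq : q = q' := by by_contra hq; simp [hq] at h₂
    exact iff_of_true hp hq
  · have h₀ := horth _ h _ h' hne
    simp only [oddRoot, Pi.single_apply, Pi.neg_apply, mul_neg, mul_ite, mul_one,
      mul_zero, Finset.sum_ite_eq', Finset.mem_univ, if_true] at h₀
    by_cases hp : p = p' <;> by_cases hq : q = q' <;> simp_all [eq_comm]

/-- A linear functional vanishing on a set vanishes on its span. -/
lemma LinearMap.eq_zero_of_mem_span {R M N : Type*} [Semiring R] [AddCommMonoid M]
    [AddCommMonoid N] [Module R M] [Module R N] (f : M →ₗ[R] N) {s : Set M}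
    (hf : ∀ x ∈ s, f x = 0) {x : M} (hx : x ∈ Submodule.span R s) : f x = 0 :=
  (Submodule.span_le (p := LinearMap.ker f)).2 hf hx

section Span

variable {m n : ℕ} {Y : Set ((Fin m → ℝ) × (Fin n → ℝ))} {x : (Fin m → ℝ) × (Fin n → ℝ)}

lemma fst_add_snd_eq_zero_of_mem_span (hodd : ∀ x ∈ Y, ∃ p q, x = oddRoot p q)
    (horth : ∀ x ∈ Y, ∀ y ∈ Y, x ≠ y →
      (∑ i, x.1 i * y.1 i) - (∑ j, x.2 j * y.2 j) = 0)
    {p : Fin m} {q : Fin n} (h : oddRoot p q ∈ Y) (hx : x ∈ Submodule.span ℝ Y) :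
    x.1 p + x.2 q = 0 := by
  refine LinearMap.eq_zero_of_mem_span
    (LinearMap.proj (φ := fun _ => ℝ) p ∘ₗ LinearMap.fst ℝ (Fin m → ℝ) (Fin n → ℝ) +
      LinearMap.proj (φ := fun _ => ℝ) q ∘ₗ LinearMap.snd ℝ (Fin m → ℝ) (Fin n → ℝ))
    ?_ hx
  intro y hy
  obtain ⟨p', q', rfl⟩ := hodd y hy
  have := oddRoot_index_eq_iff horth h hy
  by_cases hp : p = p' <;> simp_all [oddRoot]

lemma fst_eq_zero_of_mem_span (hodd : ∀ x ∈ Y, ∃ p q, x = oddRoot p q)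
    {p : Fin m} (h : ∀ q, oddRoot p q ∉ Y) (hx : x ∈ Submodule.span ℝ Y) : x.1 p = 0 := by
  refine LinearMap.eq_zero_of_mem_span
    (LinearMap.proj (φ := fun _ => ℝ) p ∘ₗ LinearMap.fst ℝ (Fin m → ℝ) (Fin n → ℝ))
    ?_ hx
  intro y hy
  obtain ⟨p', q', rfl⟩ := hodd y hy
  have hp : p ≠ p' := by rintro rfl; exact h _ hy
  simp [oddRoot, hp]

lemma snd_eq_zero_of_mem_span (hodd : ∀ x ∈ Y, ∃ p q, x = oddRoot p q)
    {q : Fin n} (h : ∀ p, oddRoot p q ∉ Y) (hx : x ∈ Submodule.span ℝ Y) : x.2 q = 0 := by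
  refine LinearMap.eq_zero_of_mem_span
    (LinearMap.proj (φ := fun _ => ℝ) q ∘ₗ LinearMap.snd ℝ (Fin m → ℝ) (Fin n → ℝ))
    ?_ hx
  intro y hy
  obtain ⟨p', q', rfl⟩ := hodd y hy
  have hq : q ≠ q' := by rintro rfl; exact h _ hy
  simp [oddRoot, hq]

end Span

/-- If `Y` is a finite set of pairwise orthogonal odd positive roots `ε_p − δ_q` of
`gl(m,n)` and `β` is any positive root of `gl(m,n)` not in `Y`, then `β` does not lie in the
`ℝ`-linear span of `Y`.  (Here `V = ℝ^m × ℝ^n` with the form `(ε_i,ε_j) = δ_{ij} = −(δ_i,δ_j)`,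
`(ε_i,δ_j) = 0`; the positive roots are `ε_i − ε_j` and `δ_i − δ_j` for `i < j`, and
`ε_i − δ_j`.) -/
theorem stmt_15 {m n : ℕ} (hm : 1 ≤ m) (hn : 1 ≤ n)
    (Y : Finset ((Fin m → ℝ) × (Fin n → ℝ)))
    (hodd : ∀ x ∈ Y, ∃ (p : Fin m) (q : Fin n),
      x = ((Pi.single p 1 : Fin m → ℝ), -(Pi.single q 1 : Fin n → ℝ)))
    (horth : ∀ x ∈ Y, ∀ y ∈ Y, x ≠ y →
      (∑ i, x.1 i * y.1 i) - (∑ j, x.2 j * y.2 j) = 0)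
    (β : (Fin m → ℝ) × (Fin n → ℝ))
    (hβ : (∃ i j : Fin m, i < j ∧
            β = ((Pi.single i 1 - Pi.single j 1 : Fin m → ℝ), (0 : Fin n → ℝ))) ∨
          (∃ i j : Fin n, i < j ∧
            β = ((0 : Fin m → ℝ), (Pi.single i 1 - Pi.single j 1 : Fin n → ℝ))) ∨
          (∃ (i : Fin m) (j : Fin n),
            β = ((Pi.single i 1 : Fin m → ℝ), -(Pi.single j 1 : Fin n → ℝ))))
    (hβY : β ∉ Y) :
    β ∉ Submodule.span ℝ (Y : Set ((Fin m → ℝ) × (Fin n → ℝ))) := by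
  intro hx
  have hadd {p : Fin m} {q : Fin n} (h : oddRoot p q ∈ Y) : β.1 p + β.2 q = 0 :=
    fst_add_snd_eq_zero_of_mem_span hodd horth h hx
  have hfst {p : Fin m} (h : ∀ q, oddRoot p q ∉ Y) : β.1 p = 0 :=
    fst_eq_zero_of_mem_span hodd h hx
  have hsnd {q : Fin n} (h : ∀ p, oddRoot p q ∉ Y) : β.2 q = 0 :=
    snd_eq_zero_of_mem_span hodd h hx
  rcases hβ with ⟨i, j, hij, rfl⟩ | ⟨i, j, hij, rfl⟩ | ⟨i, j, rfl⟩
  · by_cases h : ∃ q, oddRoot (m := m) (n := n) i q ∈ Y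
    · obtain ⟨q, hq⟩ := h
      simpa [hij.ne] using hadd hq
    · simpa [hij.ne] using hfst (not_exists.1 h)
  · by_cases h : ∃ p, oddRoot (m := m) (n := n) p i ∈ Y
    · obtain ⟨p, hp⟩ := h
      simpa [hij.ne] using hadd hp
    · simpa [hij.ne] using hsnd (not_exists.1 h)
  · by_cases h : ∃ q, oddRoot (m := m) (n := n) i q ∈ Y
    · obtain ⟨q, hq⟩ := h
      have hqj : q ≠ j := by rintro rfl; exact hβY hq
      simpa [hqj] using hadd hq
    · simpa using hfst (not_exists.1 h)
end

section
/- Let X be a finite set of pairwise orthogonal vectors in V, each of the form ε_p + c·δ_q with p ∈ {1,…,m}, q ∈ {1,…,n} and c ∈ {1,−1}. If R and S are subsets of X with Σ_{γ∈R} γ = Σ_{γ∈S} γ, then R = S. -/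
/-- If `X` is a finite set of pairwise orthogonal isotropic roots `ε_p ± δ_q` in
`V = ℝ^m × ℝ^n` (form `(ε_i,ε_j) = δ_{ij} = −(δ_i,δ_j)`, `(ε_i,δ_j) = 0`), and `R, S ⊆ X`
have the same sum, then `R = S`. -/
theorem stmt_16 {m n : ℕ} (hm : 1 ≤ m) (hn : 1 ≤ n)
    (X : Finset ((Fin m → ℝ) × (Fin n → ℝ)))
    (hshape : ∀ x ∈ X, ∃ (p : Fin m) (q : Fin n) (c : ℝ), (c = 1 ∨ c = -1) ∧
      x = ((Pi.single p 1 : Fin m → ℝ), c • (Pi.single q 1 : Fin n → ℝ)))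
    (horth : ∀ x ∈ X, ∀ y ∈ X, x ≠ y →
      (∑ i, x.1 i * y.1 i) - (∑ j, x.2 j * y.2 j) = 0)
    (R S : Finset ((Fin m → ℝ) × (Fin n → ℝ))) (hR : R ⊆ X) (hS : S ⊆ X)
    (hsum : ∑ γ ∈ R, γ = ∑ γ ∈ S, γ) :
    R = S := by
  have hcoord : ∀ x ∈ X, ∃ p, ∀ y ∈ X, y.1 p = if y = x then (1 : ℝ) else 0 := by
    intro x hx
    obtain ⟨p, q, c, hc, rfl⟩ := hshape x hx
    refine ⟨p, fun y hy => ?_⟩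
    split_ifs with h
    · simp [h]
    · have ho := horth y hy _ hx h
      obtain ⟨p', q', c', hc', rfl⟩ := hshape y hy
      by_cases hp : p' = p
      · subst hp
        by_cases hq : q' = q
        · subst hq
          refine absurd ?_ h
          rcases hc with rfl | rfl <;> rcases hc' with rfl | rfl <;>
            simp [Pi.single_apply] at ho ⊢
        · simp [Pi.single_apply, Ne.symm hq] at ho
      · simp [Ne.symm hp]
  have hmem : ∀ x ∈ X, (x ∈ R ↔ x ∈ S) := by
    intro x hx
    obtain ⟨p, hp⟩ := hcoord x hx
    have hcount : ∀ T ⊆ X, (∑ γ ∈ T, γ).1 p = if x ∈ T then (1 : ℝ) else 0 := by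
      intro T hT
      rw [Prod.fst_sum, Finset.sum_apply, Finset.sum_congr rfl fun y hy => hp y (hT hy),
        Finset.sum_ite_eq']
    have h := hcount R hR
    rw [hsum, hcount S hS] at h
    by_cases h₁ : x ∈ R <;> by_cases h₂ : x ∈ S <;> simp_all
  ext x
  exact ⟨fun h => (hmem x (hR h)).1 h, fun h => (hmem x (hS h)).2 h⟩
end

section
/- Let Δ⁺ = Δ₀⁺ ∪ Δ₁⁺ be a finite set of nonzero vectors in ℕ^d split into even roots Δ₀⁺ and odd roots Δ₁⁺. Let X ⊆ Δ₁⁺, let γ ∈ X, and let γ' ∈ Δ₁⁺ with γ' ∉ X and γ' ≠ γ; write α = γ − γ' (in the intended application γ' = s_α γ for an even positive root α). Set Y = (X \ {γ}) ∪ {γ'} (= s_α X) and Z = X ∪ {γ'}. Then for every μ ∈ ℤ^d: 𝐩_X(μ) − 𝐩_Y(μ) = 𝐩_Z(μ − γ') − 𝐩_Z(μ − γ); equivalently, writing μ₀ = μ − γ, 𝐩_X(μ) − 𝐩_{s_αX}(μ) = 𝐩_Z(μ₀ + α) − 𝐩_Z(μ₀), which is the coefficient form of the generating-function identity p_X − p_{s_αX}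 = e^{−γ'}(1 − e^{−α})·p_Z. -/
/-- The number `𝐩_W(η)` of `W`-avoiding partitions of `η`: functions `π : Δ → ℕ` with
`π(ν) ≤ 1` for every odd root `ν ∈ Δ₁`, `π(ν) = 0` for every `ν ∈ W`, and
`Σ_{ν∈Δ} π(ν)·ν = η`. -/
noncomputable def pcount {d : ℕ} (Δ Δ₁ W : Finset (Fin d → ℕ)) (η : Fin d → ℤ) : ℕ :=
  Set.ncard {π : {x // x ∈ Δ} → ℕ |
    (∀ ν : {x // x ∈ Δ}, (ν : Fin d → ℕ) ∈ Δ₁ → π ν ≤ 1) ∧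
    (∀ ν : {x // x ∈ Δ}, (ν : Fin d → ℕ) ∈ W → π ν = 0) ∧
    ∀ i : Fin d, (∑ ν : {x // x ∈ Δ}, (π ν : ℤ) * ((ν : Fin d → ℕ) i : ℤ)) = η i}

/-- The set of `W`-avoiding partitions of `η`, whose cardinality is `pcount Δ Δ₁ W η`. -/
def avoidingPartitions {d : ℕ} (Δ Δ₁ W : Finset (Fin d → ℕ)) (η : Fin d → ℤ) :
    Set ({x // x ∈ Δ} → ℕ) :=
  {π | (∀ ν : {x // x ∈ Δ}, (ν : Fin d → ℕ) ∈ Δ₁ → π ν ≤ 1) ∧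
    (∀ ν : {x // x ∈ Δ}, (ν : Fin d → ℕ) ∈ W → π ν = 0) ∧
    ∀ i : Fin d, (∑ ν : {x // x ∈ Δ}, (π ν : ℤ) * ((ν : Fin d → ℕ) i : ℤ)) = η i}

theorem finite_avoidingPartitions {d : ℕ} {Δ : Finset (Fin d → ℕ)} (hne : ∀ v ∈ Δ, v ≠ 0)
    (Δ₁ W : Finset (Fin d → ℕ)) (η : Fin d → ℤ) : (avoidingPartitions Δ Δ₁ W η).Finite := by
  refine (Set.finite_Iic (fun _ : {x // x ∈ Δ} => ∑ i, (η i).toNat)).subset ?_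
  rintro π ⟨-, -, hsum⟩ ν
  obtain ⟨i, hi⟩ := Function.ne_iff.mp (hne ν ν.2)
  have h1 : (π ν : ℤ) * ((ν : Fin d → ℕ) i : ℤ) ≤ η i := by
    rw [← hsum i]
    exact Finset.single_le_sum
      (f := fun ν : {x // x ∈ Δ} => (π ν : ℤ) * ((ν : Fin d → ℕ) i : ℤ))
      (fun _ _ => by positivity) (Finset.mem_univ ν)
  have h2 : π ν ≤ π ν * (ν : Fin d → ℕ) i := Nat.le_mul_of_pos_right _ (Nat.pos_of_ne_zero hi)
  have h3 : π ν ≤ (η i).toNat := by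
    zify at h2
    omega
  exact h3.trans (Finset.single_le_sum (f := fun i => (η i).toNat)
    (fun _ _ => Nat.zero_le _) (Finset.mem_univ i))

/-- A partition that may use the odd root `g` at most once either omits it or
arises by adding `g` to a partition that omits it. -/
theorem avoidingPartitions_eq_union {d : ℕ} {Δ Δ₁ W : Finset (Fin d → ℕ)}
    (g : {x // x ∈ Δ}) (hg₁ : (g : Fin d → ℕ) ∈ Δ₁) (hgW : (g : Fin d → ℕ) ∉ W)
    (η : Fin d → ℤ) :
    avoidingPartitions Δ Δ₁ W η = avoidingPartitions Δ Δ₁ (insert (g : Fin d → ℕ) W) η ∪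
      (· + Pi.single g 1) '' avoidingPartitions Δ Δ₁ (insert (g : Fin d → ℕ) W)
        (η - fun i => ((g : Fin d → ℕ) i : ℤ)) := by
  have hsum (π : {x // x ∈ Δ} → ℕ) (i : Fin d) :
      ∑ ν : {x // x ∈ Δ}, (((π + Pi.single g 1 : {x // x ∈ Δ} → ℕ) ν : ℕ) : ℤ) *
          ((ν : Fin d → ℕ) i : ℤ) =
        ∑ ν : {x // x ∈ Δ}, (π ν : ℤ) * ((ν : Fin d → ℕ) i : ℤ) + ((g : Fin d → ℕ) i : ℤ) := by
    simp [add_mul, Finset.sum_add_distrib, Pi.single_apply]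
  ext π
  constructor
  · rintro ⟨h1, h2, h3⟩
    rcases Nat.le_one_iff_eq_zero_or_eq_one.mp (h1 g hg₁) with h0 | h0
    · refine Or.inl ⟨h1, fun ν hν => ?_, h3⟩
      rcases Finset.mem_insert.mp hν with h | h
      · rw [Subtype.ext h, h0]
      · exact h2 ν h
    · have hπ : Function.update π g 0 + Pi.single g 1 = π := by
        ext ν
        by_cases h : ν = g
        · subst h
          simp [h0]
        · simp [h]
      refine Or.inr ⟨Function.update π g 0, ⟨fun ν hν => ?_, fun ν hν => ?_, fun i => ?_⟩, hπ⟩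
      · by_cases h : ν = g
        · simp [h]
        · simpa [h] using h1 ν hν
      · by_cases h : ν = g
        · simp [h]
        · rcases Finset.mem_insert.mp hν with h' | h'
          · exact absurd (Subtype.ext h') h
          · simpa [h] using h2 ν h'
      · have := hsum (Function.update π g 0) i
        rw [hπ, h3 i] at this
        exact eq_sub_of_add_eq this.symm
  · rintro (⟨h1, h2, h3⟩ | ⟨π, ⟨h1, h2, h3⟩, rfl⟩)
    · exact ⟨h1, fun ν hν => h2 ν (Finset.mem_insert_of_mem hν), h3⟩
    · refine ⟨fun ν hν => ?_, fun ν hν => ?_, fun i => ?_⟩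
      · by_cases h : ν = g
        · subst h
          simp [h2 ν (Finset.mem_insert_self _ _)]
        · simpa [h] using h1 ν hν
      · have h : ν ≠ g := fun h => hgW (h ▸ hν)
        simpa [h] using h2 ν (Finset.mem_insert_of_mem hν)
      · exact (hsum π i).trans (by rw [h3 i, Pi.sub_apply, sub_add_cancel])

theorem pcount_eq_add {d : ℕ} {Δ Δ₁ W : Finset (Fin d → ℕ)} (hne : ∀ v ∈ Δ, v ≠ 0)
    {g : Fin d → ℕ} (hg : g ∈ Δ) (hg₁ : g ∈ Δ₁) (hgW : g ∉ W) (η : Fin d → ℤ) :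
    pcount Δ Δ₁ W η =
      pcount Δ Δ₁ (insert g W) η + pcount Δ Δ₁ (insert g W) (η - fun i => (g i : ℤ)) := by
  change (avoidingPartitions Δ Δ₁ W η).ncard = (avoidingPartitions Δ Δ₁ (insert g W) η).ncard +
    (avoidingPartitions Δ Δ₁ (insert g W) (η - fun i => (g i : ℤ))).ncard
  rw [avoidingPartitions_eq_union ⟨g, hg⟩ hg₁ hgW, Set.ncard_union_eq _
    (finite_avoidingPartitions hne _ _ _) ((finite_avoidingPartitions hne _ _ _).image _),
    Set.ncard_image_of_injective _ (add_left_injective _)]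
  rw [Set.disjoint_left]
  rintro _ ⟨-, h, -⟩ ⟨π, -, rfl⟩
  simpa using h ⟨g, hg⟩ (Finset.mem_insert_self _ _)

/-- Partition identity: if `X ⊆ Δ₁⁺`, `γ ∈ X`, `γ' ∈ Δ₁⁺ \ (X ∪ {γ})`, and
`Y = (X \ {γ}) ∪ {γ'}`, `Z = X ∪ {γ'}`, then for every `μ ∈ ℤ^d`
`𝐩_X(μ) − 𝐩_Y(μ) = 𝐩_Z(μ − γ') − 𝐩_Z(μ − γ)`, the coefficient form of
`p_X − p_{s_αX} = e^{−γ'}(1 − e^{−α})·p_Z` where `α = γ − γ'`. -/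
theorem stmt_19 {d : ℕ} (Δ₀ Δ₁ : Finset (Fin d → ℕ))
    (hne : ∀ v ∈ Δ₀ ∪ Δ₁, v ≠ 0) (hdisj : Disjoint Δ₀ Δ₁)
    (X : Finset (Fin d → ℕ)) (hX : X ⊆ Δ₁)
    (γ : Fin d → ℕ) (hγ : γ ∈ X)
    (γ' : Fin d → ℕ) (hγ'Δ : γ' ∈ Δ₁) (hγ'X : γ' ∉ X) (hγγ' : γ' ≠ γ)
    (μ : Fin d → ℤ) :
    (pcount (Δ₀ ∪ Δ₁) Δ₁ X μ : ℤ) -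
        (pcount (Δ₀ ∪ Δ₁) Δ₁ ((X \ {γ}) ∪ {γ'}) μ : ℤ) =
      (pcount (Δ₀ ∪ Δ₁) Δ₁ (X ∪ {γ'}) (μ - fun i => (γ' i : ℤ)) : ℤ) -
        (pcount (Δ₀ ∪ Δ₁) Δ₁ (X ∪ {γ'}) (μ - fun i => (γ i : ℤ)) : ℤ) := by
  have hΔ {v : Fin d → ℕ} (hv : v ∈ Δ₁) : v ∈ Δ₀ ∪ Δ₁ := Finset.mem_union_right _ hv
  have hZ : X ∪ {γ'} = insert γ' X := by
    rw [Finset.union_comm, Finset.insert_eq]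
  have hY : insert γ (X \ {γ} ∪ {γ'}) = insert γ' X := by
    grind
  have hγY : γ ∉ X \ {γ} ∪ {γ'} := by
    simpa using hγγ'.symm
  rw [pcount_eq_add hne (hΔ hγ'Δ) hγ'Δ hγ'X, pcount_eq_add hne (hΔ (hX hγ)) (hX hγ) hγY, hY, hZ]
  push_cast
  ring
end
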